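/- Fix 0 < q < 1 and set η = −ln q. For integers L ≥ 2 and n ≥ 1, let Λ(L,n) = {−(L−1)/2, −(L−3)/2, …, (L−1)/2} × {1,…,n}, and for M with 2M ∈ ℤ define Z(L,n,M) = Σ over maps m : Λ(L,n) → {−1/2, +1/2} with Σ_{(l,j)} m(l,j) = M of q^{Σ_{(l,j)} (|l| − 2 m(l,j) l)}. Define φ_L⁻¹ : ℝ → (−L/2, L/2) by φ_L⁻¹(t) = (1/2) Σ_{l ∈ {−(L−1)/2,…,(L−1)/2}} sinh(t)/(cosh(t) + cosh(2ηl)); then φ_L⁻¹ is a strictly increasing smooth bijection onto (−L/2, L/2), and we write φ_L for its inverse. Then for every m ∈ {−L/2 + 1/n, −L/2 + 2/n, …, L/2 − 1/n} and every ε with 0 < ε < 1/4: Z(L,n,mn) ≤ q^{(n/2)⌊L²/2⌋} · √(φ_L′(m)/(2πn)) · exp(n ∫_m^{L/2} φ_L(s) ds) · (1 + ε_upper), and Z(L,n,mn) ≥ q^{(n/2)⌊L²/2⌋} · √(φ_L′(m)/(2πn)) · exp(n ∫_m^{L/2} φ_L(s) ds) · (1 − ε_lower), where ε_upper = n^{−1+2ε}/(6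 − n^{−1+2ε}) + √(2πn/φ_L′(m)) · exp(−2n^{2ε}(1 − n^{−1+2ε}/6)²/φ_L′(m)) and ε_lower = n^{−1+2ε} + 4 n^{−1+4ε} (m φ_L′(m))²/(1 − 2n^{−1+2ε})⁴ + (1 + √(2πn/φ_L′(m))) · exp(−2n^{2ε}(1 − n^{−1+2ε}/6)²/φ_L′(m)). -/

import Mathlib

open scoped Classical

noncomputable section

namespace S17

/-- The height of the `j`-th of the `L` planes: `l ∈ {−(L−1)/2, −(L−3)/2, …, (L−1)/2}`. -/
def height (L : ℕ) (j : Fin L) : ℝ := (j : ℝ) - ((L : ℝ) - 1) / 2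

/-- The spin value `m(l,j) ∈ {±1/2}` recorded by a Boolean. -/
def sval (b : Bool) : ℝ := if b then 1/2 else -1/2

/-- The canonical partition function
`Z(L,n,M) = Σ_{m : Λ(L,n) → {±1/2}, Σ m = M} q^{Σ_{(l,j)}(|l| − 2 m(l,j) l)}`. -/
def Zpart (q : ℝ) (L n : ℕ) (M : ℝ) : ℝ :=
  ∑ s ∈ Finset.univ.filter
      (fun s : Fin L × Fin n → Bool => (∑ p : Fin L × Fin n, sval (s p)) = M),
    q ^ (∑ p : Fin L × Fin n, (|height L p.1| - 2 * sval (s p) * height L p.1))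

/-- `φ_L⁻¹(t) = (1/2) Σ_{l} sinh t/(cosh t + cosh(2ηl))`, the sum over the `L` heights. -/
def phiInv (η : ℝ) (L : ℕ) (t : ℝ) : ℝ :=
  (1/2) * ∑ j : Fin L, Real.sinh t / (Real.cosh t + Real.cosh (2 * η * height L j))

end S17


namespace S17

section generic
variable {ι : Type*} [Fintype ι]

/-- The centred characteristic function. -/
def Fch (T : ι → ℝ) (x : ℝ) : ℂ :=
  (∏ p, ((Real.cos x : ℂ) + ((T p * Real.sin x : ℝ) : ℂ) * Complex.I)) *
    Complex.exp (((-((∑ p, T p) * x) : ℝ) : ℂ) * Complex.I)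

/-- Its modulus. -/
def Rm (T : ι → ℝ) (x : ℝ) : ℝ := ∏ p, √(1 - (1 - T p ^ 2) * Real.sin x ^ 2)

/-- Its phase. -/
def Ph (T : ι → ℝ) (x : ℝ) : ℝ := ∑ p, (Real.arctan (T p * Real.tan x) - T p * x)

lemma Rm_nonneg (T : ι → ℝ) (x : ℝ) : 0 ≤ Rm T x :=
  Finset.prod_nonneg fun _ _ => Real.sqrt_nonneg _

lemma norm_factor (t x : ℝ) :
    ‖((Real.cos x : ℂ) + ((t * Real.sin x : ℝ) : ℂ) * Complex.I)‖ =
      √(1 - (1 - t ^ 2) * Real.sin x ^ 2) := by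
  rw [Complex.norm_add_mul_I]
  congr 1
  have := Real.sin_sq_add_cos_sq x
  linear_combination this

lemma norm_Fch (T : ι → ℝ) (x : ℝ) : ‖Fch T x‖ = Rm T x := by
  unfold Fch Rm
  rw [norm_mul, Complex.norm_exp_ofReal_mul_I, mul_one, norm_prod]
  exact Finset.prod_congr rfl fun p _ => norm_factor _ _

lemma Rm_le (T : ι → ℝ) (x : ℝ) :
    Rm T x ≤ Real.exp (-((∑ p, (1 - T p ^ 2)) / 2) * Real.sin x ^ 2) := by
  have : Real.exp (-((∑ p, (1 - T p ^ 2)) / 2) * Real.sin x ^ 2) =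
      ∏ p, Real.exp (-((1 - T p ^ 2) * Real.sin x ^ 2) / 2) := by
    rw [← Real.exp_sum]
    congr 1
    rw [← Finset.sum_div, Finset.sum_neg_distrib, ← Finset.sum_mul]
    ring
  rw [this]
  refine Finset.prod_le_prod (fun _ _ => Real.sqrt_nonneg _) fun p _ => ?_
  rw [Real.sqrt_le_left (Real.exp_pos _).le, ← Real.exp_nat_mul]
  have := Real.add_one_le_exp (-((1 - T p ^ 2) * Real.sin x ^ 2))
  calc _ ≤ _ := by linarith
    _ ≤ _ := this
    _ = _ := by congr 1; push_cast; ring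

lemma Rm_ge (T : ι → ℝ) (hT : ∀ p, T p ^ 2 < 1) (x : ℝ) (hx : Real.sin x ^ 2 < 1) :
    Real.exp (-((∑ p, (1 - T p ^ 2)) / 2) * (Real.sin x ^ 2 / (1 - Real.sin x ^ 2))) ≤ Rm T x := by
  have : Real.exp (-((∑ p, (1 - T p ^ 2)) / 2) * (Real.sin x ^ 2 / (1 - Real.sin x ^ 2))) =
      ∏ p, Real.exp (-((1 - T p ^ 2) * (Real.sin x ^ 2 / (1 - Real.sin x ^ 2))) / 2) := by
    rw [← Real.exp_sum]
    congr 1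
    rw [← Finset.sum_div, Finset.sum_neg_distrib, ← Finset.sum_mul]
    ring
  rw [this]
  refine Finset.prod_le_prod (fun _ _ => (Real.exp_pos _).le) fun p _ => ?_
  apply Real.le_sqrt_of_sq_le
  rw [← Real.exp_nat_mul]
  set w := Real.sin x ^ 2 with hw
  have hw0 : 0 ≤ w := sq_nonneg _
  have ha0 : 0 < 1 - T p ^ 2 := by linarith [hT p]
  have ha1 : 1 - T p ^ 2 ≤ 1 := by linarith [sq_nonneg (T p)]
  set a := 1 - T p ^ 2
  have h1 : a * w ≤ w := by nlinarith
  have h2 : 0 < 1 - a * w := by linarith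
  have e1 : ((2 : ℕ) : ℝ) * (-(a * (w / (1 - w))) / 2) = -(a * (w / (1 - w))) := by
    push_cast; ring
  rw [e1, Real.exp_neg]
  have h3 : (1 - a * w)⁻¹ ≤ Real.exp (a * (w / (1 - w))) := by
    have := Real.add_one_le_exp (a * (w / (1 - w)))
    refine le_trans ?_ this
    have h4 : (1 - a * w)⁻¹ = a * w / (1 - a * w) + 1 := by field_simp; ring
    rw [h4, ← mul_div_assoc]
    have : a * w / (1 - a * w) ≤ a * w / (1 - w) := by
      apply div_le_div_of_nonneg_left (by positivity) (by linarith) (by linarith)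
    linarith
  exact inv_le_of_inv_le₀ h2 h3

lemma factor_polar (t x : ℝ) (hx : 0 < Real.cos x) :
    ((Real.cos x : ℂ) + ((t * Real.sin x : ℝ) : ℂ) * Complex.I) =
      ((√(1 - (1 - t ^ 2) * Real.sin x ^ 2) : ℝ) : ℂ) *
        Complex.exp ((Real.arctan (t * Real.tan x) : ℝ) * Complex.I) := by
  have hs := Real.sin_sq_add_cos_sq x
  have h1 : 1 - (1 - t ^ 2) * Real.sin x ^ 2 = Real.cos x ^ 2 * (1 + (t * Real.tan x) ^ 2) := by
    rw [Real.tan_eq_sin_div_cos]; field_simp; linear_combination -hs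
  have h2 : √(1 - (1 - t ^ 2) * Real.sin x ^ 2) = Real.cos x * √(1 + (t * Real.tan x) ^ 2) := by
    rw [h1, Real.sqrt_mul (sq_nonneg _), Real.sqrt_sq hx.le]
  have h3 : 0 < √(1 + (t * Real.tan x) ^ 2) := by positivity
  rw [Complex.exp_mul_I, ← Complex.ofReal_cos, ← Complex.ofReal_sin, Real.cos_arctan,
    Real.sin_arctan, h2]
  have h4 : Real.cos x * √(1 + (t * Real.tan x) ^ 2) * (1 / √(1 + (t * Real.tan x) ^ 2)) =
    Real.cos x := by field_simp
  have h5 : Real.cos x * √(1 + (t * Real.tan x) ^ 2) *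
      (t * Real.tan x / √(1 + (t * Real.tan x) ^ 2)) = t * Real.sin x := by
    have : Real.tan x * Real.cos x = Real.sin x := Real.tan_mul_cos hx.ne'
    rw [← this]; field_simp
  rw [mul_add, ← mul_assoc, ← Complex.ofReal_mul, ← Complex.ofReal_mul, h4, h5]

lemma Fch_re (T : ι → ℝ) (x : ℝ) (hx : 0 < Real.cos x) :
    (Fch T x).re = Rm T x * Real.cos (Ph T x) := by
  have : Fch T x = ((Rm T x : ℝ) : ℂ) * Complex.exp ((Ph T x : ℝ) * Complex.I) := by
    unfold Fch Rm Ph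
    rw [Finset.prod_congr rfl fun p _ => factor_polar (T p) x hx, Finset.prod_mul_distrib,
      ← Complex.exp_sum, mul_assoc, ← Complex.exp_add, Complex.ofReal_prod]
    congr 2
    rw [← Finset.sum_mul, ← add_mul, Finset.sum_sub_distrib, ← Finset.sum_mul]
    push_cast
    ring
  rw [this, Complex.re_ofReal_mul, Complex.exp_ofReal_mul_I_re]

lemma hasDerivAt_Ph (T : ι → ℝ) (x : ℝ) (hx : 0 < Real.cos x) :
    HasDerivAt (Ph T) (Real.sin x ^ 2 * ∑ p, T p * (1 - T p ^ 2) /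
      (1 - (1 - T p ^ 2) * Real.sin x ^ 2)) x := by
  unfold Ph
  rw [Finset.mul_sum]
  apply HasDerivAt.fun_sum
  intro p _
  have h := (((Real.hasDerivAt_tan hx.ne').const_mul (T p)).arctan).sub
    ((hasDerivAt_id x).const_mul (T p))
  convert! h using 1
  have hs := Real.sin_sq_add_cos_sq x
  have h1 : 1 - (1 - T p ^ 2) * Real.sin x ^ 2 =
      Real.cos x ^ 2 + T p ^ 2 * Real.sin x ^ 2 := by linear_combination -hs
  have h2 : 0 < Real.cos x ^ 2 + T p ^ 2 * Real.sin x ^ 2 := by positivity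
  rw [h1, Real.tan_eq_sin_div_cos]
  have h3 : 1 + (T p * (Real.sin x / Real.cos x)) ^ 2 =
      (Real.cos x ^ 2 + T p ^ 2 * Real.sin x ^ 2) / Real.cos x ^ 2 := by field_simp
  rw [h3]
  field_simp
  linear_combination (T p) * hs

lemma Ph_neg (T : ι → ℝ) (x : ℝ) : Ph T (-x) = - Ph T x := by
  unfold Ph
  rw [← Finset.sum_neg_distrib]
  refine Finset.sum_congr rfl fun p _ => ?_
  rw [Real.tan_neg, mul_neg, Real.arctan_neg]; ring

lemma cos_ge_half {x : ℝ} (hx : |x| ≤ 1) : 1 / 2 ≤ Real.cos x := by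
  have h := @Real.one_sub_sq_div_two_le_cos x
  have : x ^ 2 ≤ 1 := by rw [← sq_abs]; nlinarith [abs_nonneg x]
  linarith

lemma Ph_bound (T : ι → ℝ) (C x0 : ℝ) (hx0 : x0 ≤ 1)
    (hC : ∀ y, 0 ≤ y → y ≤ x0 → |∑ p, T p * (1 - T p ^ 2) /
      (1 - (1 - T p ^ 2) * Real.sin y ^ 2)| ≤ C) (x : ℝ) (hx : |x| ≤ x0) :
    |Ph T x| ≤ C * |x| ^ 3 / 3 := by
  have main : ∀ x, 0 ≤ x → x ≤ x0 → |Ph T x| ≤ C * x ^ 3 / 3 := by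
    intro x hx hxx
    have hc : ∀ y ∈ Set.Icc 0 x, 0 < Real.cos y := fun y hy => by
      have := @cos_ge_half y (by rw [abs_of_nonneg hy.1]; linarith [hy.2])
      linarith
    have hP0 : Ph T 0 = 0 := by simp [Ph]
    have key := image_norm_le_of_norm_deriv_right_le_deriv_boundary
      (f := Ph T) (a := 0) (b := x) (f' := fun y => Real.sin y ^ 2 * ∑ p, T p * (1 - T p ^ 2) /
      (1 - (1 - T p ^ 2) * Real.sin y ^ 2)) (B := fun y => C * y ^ 3 / 3)
      (B' := fun y => C * y ^ 2)
      (fun y hy => (hasDerivAt_Ph T y (hc y hy)).continuousAt.continuousWithinAt)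
      (fun y hy => (hasDerivAt_Ph T y (hc y ⟨hy.1, hy.2.le⟩)).hasDerivWithinAt)
      (by simp [hP0])
      (fun y => by
        have := ((hasDerivAt_pow 3 y).const_mul C).div_const 3
        convert! this using 1
        push_cast; ring)
      (fun y hy => by
        have h1 := hC y hy.1 (by linarith [hy.2])
        rw [Real.norm_eq_abs, abs_mul, abs_of_nonneg (sq_nonneg (Real.sin y)), mul_comm C]
        have h2 : Real.sin y ^ 2 ≤ y ^ 2 := by
          rw [sq_le_sq]; exact Real.abs_sin_le_abs
        exact mul_le_mul h2 h1 (abs_nonneg _) (sq_nonneg _))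
      (Set.right_mem_Icc.2 hx)
    simpa using key
  rcases le_total 0 x with h | h
  · rw [abs_of_nonneg h] at hx ⊢; exact main x h hx
  · rw [abs_of_nonpos h] at hx ⊢
    have := main (-x) (by linarith) hx
    rwa [Ph_neg, abs_neg] at this

/-- Lipschitz estimate. -/
lemma g_lip (w T U : ℝ) (hw0 : 0 ≤ w) (hw : w ≤ 3 / 4) (hT : T ^ 2 < 1) (hU : U ^ 2 < 1) :
    |T * (1 - T ^ 2) / (1 - (1 - T ^ 2) * w) + U * (1 - U ^ 2) / (1 - (1 - U ^ 2) * w)| ≤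
      4 * |T + U| := by
  have hD1 : 0 < 1 - (1 - T ^ 2) * w := by nlinarith [sq_nonneg T]
  have hD2 : 0 < 1 - (1 - U ^ 2) * w := by nlinarith [sq_nonneg U]
  have e : T * (1 - T ^ 2) / (1 - (1 - T ^ 2) * w) + U * (1 - U ^ 2) / (1 - (1 - U ^ 2) * w) =
      (T + U) * (((1 - w) * (1 - T ^ 2 + T * U - U ^ 2) + w * (T * U) * (1 - T * U)) /
        ((1 - (1 - T ^ 2) * w) * (1 - (1 - U ^ 2) * w))) := by
    rw [div_add_div _ _ hD1.ne' hD2.ne', mul_div_assoc']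
    congr 1
    ring
  rw [e, abs_mul, mul_comm (4 : ℝ)]
  refine mul_le_mul_of_nonneg_left ?_ (abs_nonneg _)
  rw [abs_div, abs_of_pos (mul_pos hD1 hD2), div_le_iff₀ (mul_pos hD1 hD2), abs_le]
  have hv : 0 ≤ 4 * (1 - w) - 1 := by linarith
  obtain ⟨v, hwv⟩ : ∃ v, w = 1 - v := ⟨1 - w, by ring⟩
  have hvw : 1 - w = v := by linarith
  rw [hvw] at *
  have hv1 : v ≤ 1 := by linarith
  have hv0 : 0 ≤ v := by linarith
  have hS0 : 0 ≤ T ^ 2 + U ^ 2 := by positivity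
  have hS2 : T ^ 2 + U ^ 2 ≤ 2 := by linarith
  have hP1 : T * U ≤ (T ^ 2 + U ^ 2) / 2 := by nlinarith [sq_nonneg (T - U)]
  have hP2 : -((T ^ 2 + U ^ 2) / 2) ≤ T * U := by nlinarith [sq_nonneg (T + U)]
  have hN : v * (1 - T ^ 2 + T * U - U ^ 2) + w * (T * U) * (1 - T * U) =
    v * (1 - (T ^ 2 + U ^ 2) + T * U) + w * (T * U) * (1 - T * U) := by ring
  have hD : (1 - (1 - T ^ 2) * w) * (1 - (1 - U ^ 2) * w) =
    v ^ 2 + v * w * (T ^ 2 + U ^ 2) + w ^ 2 * (T * U) ^ 2 := by rw [hwv]; ring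
  rw [hN, hD]
  generalize T ^ 2 + U ^ 2 = S at *
  generalize T * U = P at *
  have hPsq : P ^ 2 ≤ S / 2 := by nlinarith
  have a1 := mul_nonneg (by linarith : 0 ≤ v) hv
  have a2 := mul_nonneg (mul_nonneg hw0 hv) hS0
  constructor
  · rcases le_total (1 / 4) w with h | h
    · have b1 : 0 ≤ (4 * w - 1) * w * P ^ 2 :=
        mul_nonneg (mul_nonneg (by linarith) hw0) (sq_nonneg _)
      have b2 : 0 ≤ (2 - S) * (4 * v ^ 2 + v) := mul_nonneg (by linarith) (by positivity)
      have b3 : 0 ≤ S * (7 * v - 4 * v ^ 2 - 1) := mul_nonneg hS0 (by nlinarith)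
      rw [hwv] at *
      nlinarith
    · have b1 : w * P ^ 2 ≤ w * (S / 2) := mul_le_mul_of_nonneg_left hPsq hw0
      have b2 : 0 ≤ (2 - S) * (4 * v ^ 2 + v) := mul_nonneg (by linarith) (by positivity)
      have b3 : 0 ≤ S * (8 * v - 4 * v ^ 2 - 2) := mul_nonneg hS0 (by nlinarith)
      have b4 : 0 ≤ w ^ 2 * P ^ 2 := by positivity
      rw [hwv] at *
      nlinarith
  · have b1 : 0 ≤ w * (S - P) := mul_nonneg hw0 (by linarith)
    have b2 : 0 ≤ v * (S - P) := mul_nonneg (by linarith) (by linarith)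
    have b3 : 0 ≤ w ^ 2 * P ^ 2 := by positivity
    have b4 : 0 ≤ w * P ^ 2 := by positivity
    nlinarith

lemma g_abs (w T : ℝ) (hw0 : 0 ≤ w) (hw : w ≤ 1 / 2) (hT : T ^ 2 < 1) :
    |T * (1 - T ^ 2) / (1 - (1 - T ^ 2) * w)| ≤ 1 - T ^ 2 := by
  have hD1 : 0 < 1 - (1 - T ^ 2) * w := by nlinarith [sq_nonneg T]
  rw [abs_div, abs_of_pos hD1, div_le_iff₀ hD1, abs_mul, abs_of_pos (by linarith : 0 < 1 - T ^ 2),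
    mul_comm]
  refine mul_le_mul_of_nonneg_left ?_ (by linarith)
  rw [← sq_abs T] at *
  nlinarith [sq_nonneg (1 - |T|), abs_nonneg T]

lemma sum_g_abs (T : ι → ℝ) (hT : ∀ p, T p ^ 2 < 1) (w : ℝ) (hw0 : 0 ≤ w) (hw : w ≤ 1 / 2) :
    |∑ p, T p * (1 - T p ^ 2) / (1 - (1 - T p ^ 2) * w)| ≤ ∑ p, (1 - T p ^ 2) :=
  (Finset.abs_sum_le_sum_abs _ _).trans (Finset.sum_le_sum fun p _ => g_abs w _ hw0 hw (hT p))

lemma sum_g_sym (T : ι → ℝ) (hT : ∀ p, T p ^ 2 < 1) (e : ι ≃ ι)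
    (he : (∀ p, 0 ≤ T p + T (e p)) ∨ (∀ p, T p + T (e p) ≤ 0))
    (w : ℝ) (hw0 : 0 ≤ w) (hw : w ≤ 3 / 4) :
    |∑ p, T p * (1 - T p ^ 2) / (1 - (1 - T p ^ 2) * w)| ≤ 4 * |∑ p, T p| := by
  set g : ℝ → ℝ := fun t => t * (1 - t ^ 2) / (1 - (1 - t ^ 2) * w) with hg
  have h1 : ∑ p, g (T (e p)) = ∑ p, g (T p) := Equiv.sum_comp e (fun p => g (T p))
  have h1' : ∑ p, T (e p) = ∑ p, T p := Equiv.sum_comp e T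
  have h2 : 2 * ∑ p, g (T p) = ∑ p, (g (T p) + g (T (e p))) := by
    rw [Finset.sum_add_distrib, h1]; ring
  have h3 : ∑ p, |T p + T (e p)| = 2 * |∑ p, T p| := by
    have : ∑ p, (T p + T (e p)) = 2 * ∑ p, T p := by rw [Finset.sum_add_distrib, h1']; ring
    have h4 : ∑ p, |T p + T (e p)| = |∑ p, (T p + T (e p))| := by
      rcases he with h | h
      · rw [abs_of_nonneg (Finset.sum_nonneg fun p _ => h p)]
        exact Finset.sum_congr rfl fun p _ => abs_of_nonneg (h p)
      · rw [abs_of_nonpos (Finset.sum_nonpos fun p _ => h p), ← Finset.sum_neg_distrib]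
        exact Finset.sum_congr rfl fun p _ => abs_of_nonpos (h p)
    rw [h4, this, abs_mul]; norm_num
  have h5 : |2 * ∑ p, g (T p)| ≤ ∑ p, 4 * |T p + T (e p)| := by
    rw [h2]
    exact (Finset.abs_sum_le_sum_abs _ _).trans
      (Finset.sum_le_sum fun p _ => g_lip w _ _ hw0 hw (hT p) (hT (e p)))
  rw [← Finset.mul_sum, h3, abs_mul] at h5
  norm_num at h5
  change |∑ p, g (T p)| ≤ _
  linarith

end generic
end S17

namespace S17
section generic2
variable {ι : Type*} [Fintype ι]

lemma continuous_Fch (T : ι → ℝ) : Continuous (Fch T) := by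
  unfold Fch
  fun_prop

/-- The integral representation of the local probability. -/
def Iint (T : ι → ℝ) : ℝ := ∫ x in (-(Real.pi / 2))..(Real.pi / 2), (Fch T x).re

lemma sin_sq_ge {δ x : ℝ} (hδ1 : δ ≤ 1) (hx : |x| ≤ √δ) (hδ : 0 < δ) :
    x ^ 2 * (1 - δ / 6) ^ 2 ≤ Real.sin x ^ 2 := by
  have main : ∀ y, 0 ≤ y → y ≤ √δ → y ^ 2 * (1 - δ / 6) ^ 2 ≤ Real.sin y ^ 2 := by
    intro y hy hy1
    have h := Real.sin_ge_sub_cube hy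
    have h2 : y ^ 2 ≤ δ := by
      calc y ^ 2 ≤ √δ ^ 2 := by gcongr
        _ = δ := Real.sq_sqrt hδ.le
    have h3 : y * (1 - δ / 6) ≤ Real.sin y := by nlinarith
    have h4 : 0 ≤ y * (1 - δ / 6) := mul_nonneg hy (by linarith)
    nlinarith
  rcases le_total 0 x with h | h
  · rw [abs_of_nonneg h] at hx; exact main x h hx
  · rw [abs_of_nonpos h] at hx
    have := main (-x) (by linarith) hx
    simpa using this

lemma sin_sq_ge' {δ x : ℝ} (hδ1 : δ ≤ 1) (hx : √δ ≤ |x|) (hx2 : |x| ≤ Real.pi / 2) (hδ : 0 < δ) :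
    δ * (1 - δ / 6) ^ 2 ≤ Real.sin x ^ 2 := by
  have h0 : 0 ≤ √δ := Real.sqrt_nonneg _
  have h := @sin_sq_ge δ (√δ) hδ1 (by rw [abs_of_nonneg h0]) hδ
  rw [Real.sq_sqrt hδ.le] at h
  have h1 : Real.sin x ^ 2 = Real.sin |x| ^ 2 := by
    rcases abs_choice x with h | h <;> rw [h]
    rw [Real.sin_neg, neg_sq]
  rw [h1]
  refine h.trans ?_
  have hpi := Real.pi_pos
  have h2 : Real.sin (√δ) ≤ Real.sin |x| :=
    Real.sin_le_sin_of_le_of_le_pi_div_two (by linarith) hx2 hx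
  have h3 : 0 ≤ Real.sin (√δ) := Real.sin_nonneg_of_nonneg_of_le_pi h0 (by linarith)
  gcongr

lemma Rm_le_mid (T : ι → ℝ) (hA : 0 < ∑ p, (1 - T p ^ 2)) {δ x : ℝ} (hδ : 0 < δ) (hδ1 : δ ≤ 1)
    (hx : |x| ≤ √δ) :
    Rm T x ≤ Real.exp (-((∑ p, (1 - T p ^ 2)) / 2 * (1 - δ / 6) ^ 2) * x ^ 2) := by
  refine (Rm_le T x).trans ?_
  apply Real.exp_le_exp.2
  have := mul_le_mul_of_nonneg_left (sin_sq_ge hδ1 hx hδ) (half_pos hA).le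
  linarith

lemma Rm_le_out (T : ι → ℝ) (hA : 0 < ∑ p, (1 - T p ^ 2)) {δ x : ℝ} (hδ : 0 < δ) (hδ1 : δ ≤ 1)
    (hx : √δ ≤ |x|) (hx2 : |x| ≤ Real.pi / 2) :
    Rm T x ≤ Real.exp (-((∑ p, (1 - T p ^ 2)) / 2 * (1 - δ / 6) ^ 2) * δ) := by
  refine (Rm_le T x).trans ?_
  apply Real.exp_le_exp.2
  have := mul_le_mul_of_nonneg_left (sin_sq_ge' hδ1 hx hx2 hδ) (half_pos hA).le
  linarith

lemma abs_re_le (T : ι → ℝ) (x : ℝ) : |(Fch T x).re| ≤ Rm T x := by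
  rw [← norm_Fch]; exact Complex.abs_re_le_norm _

lemma gauss_le {β a b : ℝ} (hβ : 0 < β) (hab : a ≤ b) :
    ∫ x in a..b, Real.exp (-β * x ^ 2) ≤ √(Real.pi / β) := by
  rw [← integral_gaussian, intervalIntegral.integral_of_le hab]
  exact MeasureTheory.setIntegral_le_integral (integrable_exp_neg_mul_sq hβ)
    (Filter.Eventually.of_forall fun x => (Real.exp_pos _).le)

theorem Iint_upper (T : ι → ℝ) (hA : 0 < ∑ p, (1 - T p ^ 2)) {δ : ℝ} (hδ : 0 < δ) (hδ1 : δ ≤ 1) :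
    Iint T ≤ √(Real.pi / ((∑ p, (1 - T p ^ 2)) / 2 * (1 - δ / 6) ^ 2)) +
      Real.pi * Real.exp (-((∑ p, (1 - T p ^ 2)) / 2 * (1 - δ / 6) ^ 2) * δ) := by
  set β := (∑ p, (1 - T p ^ 2)) / 2 * (1 - δ / 6) ^ 2 with hβ
  have hβ0 : 0 < β := by
    have : 0 < 1 - δ / 6 := by linarith
    positivity
  have hpi := Real.pi_pos
  have hle : -(Real.pi / 2) ≤ Real.pi / 2 := by linarith
  have hc := continuous_Fch T
  have h1 : Iint T ≤ ∫ x in (-(Real.pi / 2))..(Real.pi / 2),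
      (Real.exp (-β * x ^ 2) + Real.exp (-β * δ)) := by
    unfold Iint
    apply intervalIntegral.integral_mono_on hle
    · exact (Complex.continuous_re.comp hc).intervalIntegrable _ _
    · exact (by fun_prop : Continuous fun x : ℝ =>
        (Real.exp (-β * x ^ 2) + Real.exp (-β * δ))).intervalIntegrable _ _
    · intro x hx
      have hx' : |x| ≤ Real.pi / 2 := abs_le.2 ⟨hx.1, hx.2⟩
      have h2 := (le_abs_self _).trans (abs_re_le T x)
      have := Real.exp_pos (-β * x ^ 2)
      have := Real.exp_pos (-β * δ)
      rcases le_total |x| (√δ) with h | h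
      · have := Rm_le_mid T hA hδ hδ1 h
        linarith
      · have := Rm_le_out T hA hδ hδ1 h hx'
        linarith
  refine h1.trans ?_
  rw [intervalIntegral.integral_add, intervalIntegral.integral_const]
  · have := gauss_le hβ0 hle
    rw [smul_eq_mul]
    have e : Real.pi / 2 - -(Real.pi / 2) = Real.pi := by ring
    rw [e]
    linarith
  · exact (by fun_prop : Continuous fun x : ℝ => Real.exp (-β * x ^ 2)).intervalIntegrable _ _
  · exact continuous_const.intervalIntegrable _ _

lemma gauss_mid {b x0 : ℝ} (hb : 0 < b) (hx0 : 0 ≤ x0) :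
    √(Real.pi / b) * (1 - Real.exp (-b * x0 ^ 2)) ≤ ∫ x in (-x0)..x0, Real.exp (-b * x ^ 2) := by
  have hc : Continuous fun x : ℝ => Real.exp (-b * x ^ 2) := by fun_prop
  have hintg := integrable_exp_neg_mul_sq hb
  have h1 : ∫ x in (-x0)..x0, Real.exp (-b * x ^ 2) = 2 * ∫ x in (0 : ℝ)..x0, Real.exp (-b * x ^ 2) := by
    rw [← intervalIntegral.integral_add_adjacent_intervals (hc.intervalIntegrable (-x0) 0)
      (hc.intervalIntegrable 0 x0)]
    have := intervalIntegral.integral_comp_neg (a := 0) (b := x0)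
      (fun x : ℝ => Real.exp (-b * x ^ 2))
    simp only [neg_sq, neg_zero] at this
    rw [← this]; ring
  have h2 : ∫ x in (0 : ℝ)..x0, Real.exp (-b * x ^ 2) =
      (∫ x in Set.Ioi (0 : ℝ), Real.exp (-b * x ^ 2)) -
        ∫ x in Set.Ioi x0, Real.exp (-b * x ^ 2) := by
    rw [← intervalIntegral.integral_Ioi_sub_Ioi hintg.integrableOn hx0]
  have h3 : ∫ x in Set.Ioi x0, Real.exp (-b * x ^ 2) ≤
      Real.exp (-b * x0 ^ 2) * ∫ x in Set.Ioi (0 : ℝ), Real.exp (-b * x ^ 2) := by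
    have e := (MeasureTheory.measurePreserving_add_right MeasureTheory.volume x0).setIntegral_preimage_emb
      (measurableEmbedding_addRight x0) (fun x : ℝ => Real.exp (-b * x ^ 2)) (Set.Ioi x0)
    have e2 : (fun x : ℝ => x + x0) ⁻¹' Set.Ioi x0 = Set.Ioi 0 := by ext x; simp
    rw [e2] at e
    rw [← e, ← MeasureTheory.integral_const_mul]
    have hi2 : MeasureTheory.Integrable (fun x : ℝ => Real.exp (-b * (x + x0) ^ 2)) :=
      hintg.comp_add_right x0
    refine MeasureTheory.setIntegral_mono_on hi2.integrableOn
      (hintg.const_mul _).integrableOn measurableSet_Ioi fun x hx => ?_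
    rw [← Real.exp_add]
    apply Real.exp_le_exp.2
    have hx : 0 < x := hx
    have : 0 ≤ b * (2 * x * x0) := by positivity
    linarith
  rw [integral_gaussian_Ioi] at h2 h3
  rw [h1, h2]
  linarith

lemma moment_four {β x0 : ℝ} (hβ : 0 < β) (hx0 : 0 ≤ x0) :
    ∫ x in (-x0)..x0, x ^ 4 * Real.exp (-β * x ^ 2) ≤ 3 / (4 * β ^ 2) * √(Real.pi / β) := by
  have hc : Continuous fun x : ℝ => Real.exp (-β * x ^ 2) := by fun_prop
  have hc4 : Continuous fun x : ℝ => x ^ 4 * Real.exp (-β * x ^ 2) := by fun_prop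
  have hd : ∀ x : ℝ, HasDerivAt
      (fun x : ℝ => -((x ^ 3 / (2 * β) + 3 * x / (4 * β ^ 2)) * Real.exp (-β * x ^ 2)))
      (x ^ 4 * Real.exp (-β * x ^ 2) - 3 / (4 * β ^ 2) * Real.exp (-β * x ^ 2)) x := by
    intro x
    have h1 : HasDerivAt (fun x : ℝ => Real.exp (-β * x ^ 2))
        (Real.exp (-β * x ^ 2) * (-β * (2 * x))) x := by
      have := ((hasDerivAt_pow 2 x).const_mul (-β)).exp
      convert! this using 1
      push_cast; ring
    have h2 : HasDerivAt (fun x : ℝ => x ^ 3 / (2 * β) + 3 * x / (4 * β ^ 2))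
        (3 * x ^ 2 / (2 * β) + 3 / (4 * β ^ 2)) x := by
      have := ((hasDerivAt_pow 3 x).div_const (2 * β)).add
        (((hasDerivAt_id x).const_mul 3).div_const (4 * β ^ 2))
      convert! this using 1
      push_cast; ring
    have := (h2.mul h1).neg
    convert! this using 1
    field_simp
    ring
  have hi := intervalIntegral.integral_eq_sub_of_hasDerivAt (a := -x0) (b := x0)
    (fun x _ => hd x) ((hc4.sub (hc.const_smul (3 / (4 * β ^ 2)))).intervalIntegrable _ _)
  have hc5 : Continuous fun x : ℝ => 3 / (4 * β ^ 2) * Real.exp (-β * x ^ 2) := by fun_prop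
  rw [intervalIntegral.integral_sub (hc4.intervalIntegrable _ _)
    (hc5.intervalIntegrable _ _), intervalIntegral.integral_const_mul] at hi
  have hg := gauss_le hβ (by linarith : -x0 ≤ x0)
  have hp : 0 ≤ (x0 ^ 3 / (2 * β) + 3 * x0 / (4 * β ^ 2)) * Real.exp (-β * x0 ^ 2) := by positivity
  have hg2 : 3 / (4 * β ^ 2) * ∫ x in (-x0)..x0, Real.exp (-β * x ^ 2) ≤
    3 / (4 * β ^ 2) * √(Real.pi / β) := mul_le_mul_of_nonneg_left hg (by positivity)
  have hn : -(((-x0) ^ 3 / (2 * β) + 3 * (-x0) / (4 * β ^ 2)) * Real.exp (-β * (-x0) ^ 2)) =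
    (x0 ^ 3 / (2 * β) + 3 * x0 / (4 * β ^ 2)) * Real.exp (-β * x0 ^ 2) := by
    rw [neg_sq]; ring
  rw [hn] at hi
  linarith

theorem Iint_lower (T : ι → ℝ) (hT : ∀ p, T p ^ 2 < 1) (hA : 0 < ∑ p, (1 - T p ^ 2)) {δ C : ℝ}
    (hδ : 0 < δ) (hδ1 : δ < 1) 
    (hC : ∀ y, 0 ≤ y → y ≤ √δ → |∑ p, T p * (1 - T p ^ 2) /
      (1 - (1 - T p ^ 2) * Real.sin y ^ 2)| ≤ C) :
    √(Real.pi / ((∑ p, (1 - T p ^ 2)) / 2 / (1 - δ))) *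
        (1 - Real.exp (-((∑ p, (1 - T p ^ 2)) / 2 / (1 - δ)) * δ)) -
      C ^ 2 * δ / 18 * (3 / (4 * ((∑ p, (1 - T p ^ 2)) / 2 * (1 - δ / 6) ^ 2) ^ 2) *
        √(Real.pi / ((∑ p, (1 - T p ^ 2)) / 2 * (1 - δ / 6) ^ 2))) -
      Real.pi * Real.exp (-((∑ p, (1 - T p ^ 2)) / 2 * (1 - δ / 6) ^ 2) * δ) ≤ Iint T := by
  set β := (∑ p, (1 - T p ^ 2)) / 2 * (1 - δ / 6) ^ 2 with hβ
  set b := (∑ p, (1 - T p ^ 2)) / 2 / (1 - δ) with hb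
  have hd : 0 < 1 - δ := by linarith
  have hβ0 : 0 < β := by
    have : 0 < 1 - δ / 6 := by linarith
    positivity
  have hb0 : 0 < b := by positivity
  have hpi := Real.pi_gt_three
  set x0 := √δ with hx0
  have hx00 : 0 ≤ x0 := Real.sqrt_nonneg _
  have hx0sq : x0 ^ 2 = δ := Real.sq_sqrt hδ.le
  have hx01 : x0 ≤ 1 := by rw [hx0]; exact Real.sqrt_le_one.2 hδ1.le
  have hc : Continuous fun x => (Fch T x).re := Complex.continuous_re.comp (continuous_Fch T)
  have hsplit : Iint T = (∫ x in (-(Real.pi / 2))..(-x0), (Fch T x).re) +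
      (∫ x in (-x0)..x0, (Fch T x).re) + ∫ x in x0..(Real.pi / 2), (Fch T x).re := by
    unfold Iint
    rw [intervalIntegral.integral_add_adjacent_intervals (hc.intervalIntegrable _ _)
      (hc.intervalIntegrable _ _), intervalIntegral.integral_add_adjacent_intervals
      (hc.intervalIntegrable _ _) (hc.intervalIntegrable _ _)]
  have hE := Real.exp_pos (-β * δ)
  have hout1 : -((Real.pi / 2 - x0) * Real.exp (-β * δ)) ≤
      ∫ x in (-(Real.pi / 2))..(-x0), (Fch T x).re := by
    have := intervalIntegral.integral_mono_on (μ := MeasureTheory.volume) (a := -(Real.pi / 2)) (b := -x0) (by linarith)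
      (f := fun _ => -Real.exp (-β * δ)) (continuous_const.intervalIntegrable _ _)
      (hc.intervalIntegrable _ _) (fun x hx => by
        have hx1 : x ≤ 0 := by linarith [hx.2]
        have h1 := Rm_le_out T hA hδ hδ1.le (x := x)
          (by rw [abs_of_nonpos hx1]; linarith [hx.2]) (by rw [abs_of_nonpos hx1]; linarith [hx.1])
        have h2 := neg_abs_le (Fch T x).re
        have h3 := abs_re_le T x
        linarith)
    rw [intervalIntegral.integral_const, smul_eq_mul] at this
    linarith
  have hout2 : -((Real.pi / 2 - x0) * Real.exp (-β * δ)) ≤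
      ∫ x in x0..(Real.pi / 2), (Fch T x).re := by
    have := intervalIntegral.integral_mono_on (μ := MeasureTheory.volume) (a := x0) (b := Real.pi / 2) (by linarith)
      (f := fun _ => -Real.exp (-β * δ)) (continuous_const.intervalIntegrable _ _)
      (hc.intervalIntegrable _ _) (fun x hx => by
        have hx1 : 0 ≤ x := by linarith [hx.1]
        have h1 := Rm_le_out T hA hδ hδ1.le (x := x)
          (by rw [abs_of_nonneg hx1]; linarith [hx.1]) (by rw [abs_of_nonneg hx1]; linarith [hx.2])
        have h2 := neg_abs_le (Fch T x).re
        have h3 := abs_re_le T x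
        linarith)
    rw [intervalIntegral.integral_const, smul_eq_mul] at this
    linarith
  have hc1 : Continuous fun x : ℝ => Real.exp (-b * x ^ 2) := by fun_prop
  have hc2 : Continuous fun x : ℝ => C ^ 2 * δ / 18 * (x ^ 4 * Real.exp (-β * x ^ 2)) := by fun_prop
  have hmid : (∫ x in (-x0)..x0, (Real.exp (-b * x ^ 2) -
      C ^ 2 * δ / 18 * (x ^ 4 * Real.exp (-β * x ^ 2)))) ≤ ∫ x in (-x0)..x0, (Fch T x).re := by
    apply intervalIntegral.integral_mono_on (μ := MeasureTheory.volume) (by linarith)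
      ((hc1.sub hc2).intervalIntegrable (μ := MeasureTheory.volume) _ _) (hc.intervalIntegrable _ _)
    intro x hx
    have hxa : |x| ≤ x0 := abs_le.2 ⟨hx.1, hx.2⟩
    have hcos := cos_ge_half (hxa.trans hx01)
    rw [Fch_re T x (by linarith)]
    have hph := Ph_bound T C x0 hx01 hC x hxa
    have hcp := @Real.one_sub_sq_div_two_le_cos (Ph T x)
    have hx2 : x ^ 2 ≤ δ := by
      rw [← hx0sq, ← sq_abs]; gcongr
    have hs2 : Real.sin x ^ 2 ≤ x ^ 2 := by
      rw [sq_le_sq]; exact Real.abs_sin_le_abs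
    have hlow : Real.exp (-b * x ^ 2) ≤ Rm T x := by
      refine le_trans ?_ (Rm_ge T hT x (by linarith))
      apply Real.exp_le_exp.2
      have : Real.sin x ^ 2 / (1 - Real.sin x ^ 2) ≤ x ^ 2 / (1 - δ) :=
        div_le_div₀ (sq_nonneg _) hs2 hd (by linarith)
      have := mul_le_mul_of_nonneg_left this (half_pos hA).le
      have e : b * x ^ 2 = (∑ p, (1 - T p ^ 2)) / 2 * (x ^ 2 / (1 - δ)) := by rw [hb]; ring
      linarith
    have hup := Rm_le_mid T hA hδ hδ1.le hxa
    rw [← hβ] at hup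
    have hph2 : Ph T x ^ 2 ≤ C ^ 2 * δ * x ^ 4 / 9 := by
      have h1 : Ph T x ^ 2 ≤ (C * |x| ^ 3 / 3) ^ 2 := by
        rw [← sq_abs]; gcongr
      have h2 : (C * |x| ^ 3 / 3) ^ 2 = C ^ 2 * x ^ 2 * x ^ 4 / 9 := by
        have : |x| ^ 6 = x ^ 6 := by
          rw [show |x| ^ 6 = (|x| ^ 2) ^ 3 by ring, sq_abs]; ring
        linear_combination C ^ 2 / 9 * this
      rw [h2] at h1
      refine h1.trans ?_
      gcongr
    have hR := Rm_nonneg T x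
    calc Real.exp (-b * x ^ 2) - C ^ 2 * δ / 18 * (x ^ 4 * Real.exp (-β * x ^ 2))
        ≤ Rm T x - C ^ 2 * δ / 18 * (x ^ 4 * Rm T x) := by
          gcongr
      _ = Rm T x * (1 - C ^ 2 * δ * x ^ 4 / 9 / 2) := by ring
      _ ≤ Rm T x * Real.cos (Ph T x) := by
          apply mul_le_mul_of_nonneg_left _ hR
          linarith
  rw [intervalIntegral.integral_sub (hc1.intervalIntegrable _ _) (hc2.intervalIntegrable _ _),
    intervalIntegral.integral_const_mul] at hmid
  have hg := gauss_mid hb0 hx00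
  rw [hx0sq] at hg
  have h4 := mul_le_mul_of_nonneg_left (moment_four hβ0 hx00)
    (by positivity : 0 ≤ C ^ 2 * δ / 18)
  rw [hsplit]
  nlinarith [mul_nonneg hx00 hE.le]

end generic2
end S17

namespace S17

lemma height_rev (L : ℕ) (j : Fin L) : height L (Fin.rev j) = -height L j := by
  unfold height
  rw [Fin.val_rev, Nat.cast_sub (by omega)]
  push_cast; ring

lemma tanh_pair (p r : ℝ) :
    Real.tanh p + Real.tanh r = 2 * (Real.sinh (p + r) / (Real.cosh (p + r) + Real.cosh (p - r))) := by
  have h1 := Real.cosh_pos p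
  have h2 := Real.cosh_pos r
  have h3 : Real.cosh (p + r) + Real.cosh (p - r) = 2 * (Real.cosh p * Real.cosh r) := by
    rw [Real.cosh_add, Real.cosh_sub]; ring
  rw [h3, Real.sinh_add, Real.tanh_eq_sinh_div_cosh, Real.tanh_eq_sinh_div_cosh]
  field_simp

lemma tanh_sum_rev (η : ℝ) (L : ℕ) (t : ℝ) (j : Fin L) :
    Real.tanh (t / 2 + η * height L j) + Real.tanh (t / 2 + η * height L (Fin.rev j)) =
      2 * (Real.sinh t / (Real.cosh t + Real.cosh (2 * η * height L j))) := by
  rw [height_rev, tanh_pair]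
  congr 3
  · congr 1; ring
  · congr 1; ring
  · congr 1; ring

lemma phiInv_eq (η : ℝ) (L : ℕ) (t : ℝ) :
    phiInv η L t = 1 / 2 * ∑ j : Fin L, Real.tanh (t / 2 + η * height L j) := by
  have h1 : ∑ j : Fin L, Real.tanh (t / 2 + η * height L (Fin.rev j)) =
      ∑ j : Fin L, Real.tanh (t / 2 + η * height L j) :=
    Equiv.sum_comp Fin.revPerm (fun j => Real.tanh (t / 2 + η * height L j))
  have h2 : ∑ j : Fin L, (Real.tanh (t / 2 + η * height L j) +
      Real.tanh (t / 2 + η * height L (Fin.rev j))) =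
      ∑ j : Fin L, 2 * (Real.sinh t / (Real.cosh t + Real.cosh (2 * η * height L j))) :=
    Finset.sum_congr rfl fun j _ => tanh_sum_rev η L t j
  rw [Finset.sum_add_distrib, h1, ← Finset.mul_sum] at h2
  unfold phiInv
  linarith

lemma hasStrictDerivAt_tanh (x : ℝ) : HasStrictDerivAt Real.tanh (1 - Real.tanh x ^ 2) x := by
  have h := (Real.hasStrictDerivAt_sinh x).div (Real.hasStrictDerivAt_cosh x) (Real.cosh_pos x).ne'
  have e : Real.tanh = Real.sinh / Real.cosh := by
    funext y; exact Real.tanh_eq_sinh_div_cosh y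
  rw [e]
  convert! h using 1
  have := Real.cosh_pos x
  simp only [Pi.div_apply]
  field_simp

lemma hasStrictDerivAt_phiInv (η : ℝ) (L : ℕ) (t : ℝ) :
    HasStrictDerivAt (phiInv η L) (1 / 4 * ∑ j : Fin L, (1 - Real.tanh (t / 2 + η * height L j) ^ 2)) t := by
  have e : phiInv η L = fun t => 1 / 2 * ∑ j : Fin L, Real.tanh (t / 2 + η * height L j) := by
    funext t; exact phiInv_eq η L t
  rw [e]
  have h : ∀ j ∈ (Finset.univ : Finset (Fin L)), HasStrictDerivAt
      (fun t : ℝ => Real.tanh (t / 2 + η * height L j))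
      ((1 - Real.tanh (t / 2 + η * height L j) ^ 2) * (1 / 2)) t := by
    intro j _
    have h1 : HasStrictDerivAt (fun t : ℝ => t / 2 + η * height L j) (1 / 2) t :=
      ((hasStrictDerivAt_id t).div_const 2).add_const _
    exact (hasStrictDerivAt_tanh _).comp t h1
  have := (HasStrictDerivAt.fun_sum h).const_mul (1 / 2)
  convert! this using 1
  rw [← Finset.sum_mul]; ring

lemma var_pos (η : ℝ) (L : ℕ) (hL : 2 ≤ L) (t : ℝ) :
    0 < ∑ j : Fin L, (1 - Real.tanh (t / 2 + η * height L j) ^ 2) := by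
  have : Nonempty (Fin L) := ⟨⟨0, by omega⟩⟩
  exact Finset.sum_pos (fun j _ => by linarith [Real.tanh_sq_lt_one (t / 2 + η * height L j)])
    Finset.univ_nonempty

lemma phiInv_strictMono (η : ℝ) (L : ℕ) (hL : 2 ≤ L) : StrictMono (phiInv η L) := by
  apply strictMono_of_deriv_pos
  intro t
  rw [(hasStrictDerivAt_phiInv η L t).hasDerivAt.deriv]
  have := var_pos η L hL t
  positivity

lemma phiInv_contDiff (η : ℝ) (L : ℕ) : ContDiff ℝ (⊤ : ℕ∞) (phiInv η L) := by
  unfold phiInv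
  refine contDiff_const.mul (ContDiff.sum fun j _ => ?_)
  refine Real.contDiff_sinh.div (Real.contDiff_cosh.add contDiff_const) fun t => ?_
  have := Real.cosh_pos t
  have := Real.cosh_pos (2 * η * height L j)
  positivity

lemma one_sub_tanh (x : ℝ) : 1 - Real.tanh x = 2 / (Real.exp (2 * x) + 1) := by
  rw [Real.tanh_eq, Real.exp_neg, two_mul, Real.exp_add]
  have := Real.exp_pos x
  field_simp
  ring

lemma tendsto_tanh_atTop : Filter.Tendsto Real.tanh Filter.atTop (nhds 1) := by
  have h : Filter.Tendsto (fun x : ℝ => 1 - 2 / (Real.exp (2 * x) + 1)) Filter.atTop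
      (nhds (1 - 0)) := by
    refine tendsto_const_nhds.sub (Filter.Tendsto.div_atTop tendsto_const_nhds ?_)
    apply Filter.tendsto_atTop_add_const_right
    exact Real.tendsto_exp_atTop.comp (Filter.tendsto_id.const_mul_atTop (by norm_num))
  rw [sub_zero] at h
  refine h.congr fun x => ?_
  rw [← one_sub_tanh]; ring

lemma phiInv_neg (η : ℝ) (L : ℕ) (t : ℝ) : phiInv η L (-t) = - phiInv η L t := by
  unfold phiInv
  simp only [Real.sinh_neg, Real.cosh_neg, neg_div, Finset.sum_neg_distrib, mul_neg]

lemma tendsto_phiInv_atTop (η : ℝ) (L : ℕ) :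
    Filter.Tendsto (phiInv η L) Filter.atTop (nhds ((L : ℝ) / 2)) := by
  have h : Filter.Tendsto (fun t => 1 / 2 * ∑ j : Fin L, Real.tanh (t / 2 + η * height L j))
      Filter.atTop (nhds (1 / 2 * ∑ _j : Fin L, (1 : ℝ))) := by
    refine (tendsto_finsetSum _ fun j _ => ?_).const_mul _
    refine tendsto_tanh_atTop.comp ?_
    apply Filter.tendsto_atTop_add_const_right
    exact Filter.tendsto_id.atTop_div_const (by norm_num)
  simp only [Finset.sum_const, Finset.card_univ, Fintype.card_fin, nsmul_eq_mul, mul_one] at h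
  convert h.congr fun t => (phiInv_eq η L t).symm using 2
  ring

lemma phiInv_mem (η : ℝ) (L : ℕ) (hL : 2 ≤ L) (t : ℝ) :
    phiInv η L t ∈ Set.Ioo (-(L : ℝ) / 2) ((L : ℝ) / 2) := by
  have h : ∀ t, phiInv η L t < (L : ℝ) / 2 := by
    intro t
    have h1 : phiInv η L t < phiInv η L (t + 1) := phiInv_strictMono η L hL (by linarith)
    have h2 : phiInv η L (t + 1) ≤ (L : ℝ) / 2 :=
      (phiInv_strictMono η L hL).monotone.ge_of_tendsto (tendsto_phiInv_atTop η L) _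
    linarith
  refine ⟨?_, h t⟩
  have := h (-t)
  rw [phiInv_neg] at this
  linarith

lemma phiInv_range (η : ℝ) (L : ℕ) (hL : 2 ≤ L) :
    Set.range (phiInv η L) = Set.Ioo (-(L : ℝ) / 2) ((L : ℝ) / 2) := by
  apply Set.Subset.antisymm
  · rintro _ ⟨t, rfl⟩; exact phiInv_mem η L hL t
  · intro s hs
    have hc : Continuous (phiInv η L) := (phiInv_contDiff η L).continuous
    have h1 := ((tendsto_phiInv_atTop η L).eventually (lt_mem_nhds hs.2)).exists
    have h2 := ((tendsto_phiInv_atTop η L).eventually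
      (lt_mem_nhds (by linarith [hs.1] : -s < (L : ℝ) / 2))).exists
    obtain ⟨a, ha⟩ := h1
    obtain ⟨b, hb⟩ := h2
    refine mem_range_of_exists_le_of_exists_ge hc ⟨-b, ?_⟩ ⟨a, ha.le⟩
    rw [phiInv_neg]; linarith

/-- The log-generating function. -/
def Gf (η : ℝ) (L : ℕ) (t : ℝ) : ℝ := ∑ j : Fin L, Real.log (2 * Real.cosh (t / 2 + η * height L j))

lemma hasDerivAt_Gf (η : ℝ) (L : ℕ) (t : ℝ) : HasDerivAt (Gf η L) (phiInv η L t) t := by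
  rw [phiInv_eq, Finset.mul_sum]
  unfold Gf
  apply HasDerivAt.fun_sum
  intro j _
  have h1 : HasDerivAt (fun t : ℝ => t / 2 + η * height L j) (1 / 2) t :=
    ((hasDerivAt_id t).div_const 2).add_const _
  have hp := Real.cosh_pos (t / 2 + η * height L j)
  have h2 := ((h1.cosh).const_mul 2).log (by positivity)
  convert! h2 using 1
  rw [Real.tanh_eq_sinh_div_cosh]
  field_simp

lemma sum_height (L : ℕ) : ∑ j : Fin L, height L j = 0 := by
  have h1 : ∑ j : Fin L, height L (Fin.rev j) = ∑ j : Fin L, height L j :=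
    Equiv.sum_comp Fin.revPerm (fun j => height L j)
  simp only [height_rev, Finset.sum_neg_distrib] at h1
  linarith

lemma log_two_cosh (x : ℝ) : Real.log (2 * Real.cosh x) = x + Real.log (1 + Real.exp (-(2 * x))) := by
  have : 2 * Real.cosh x = Real.exp x * (1 + Real.exp (-(2 * x))) := by
    rw [Real.cosh_eq, mul_add, ← Real.exp_add]; ring_nf
  rw [this, Real.log_mul (Real.exp_pos _).ne' (by positivity), Real.log_exp]

lemma tendsto_Gf (η : ℝ) (L : ℕ) :
    Filter.Tendsto (fun t => Gf η L t - t * ((L : ℝ) / 2)) Filter.atTop (nhds 0) := by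
  have h : Filter.Tendsto (fun t => ∑ j : Fin L,
      Real.log (1 + Real.exp (-(2 * (t / 2 + η * height L j))))) Filter.atTop
      (nhds (∑ _j : Fin L, (0 : ℝ))) := by
    refine tendsto_finsetSum _ fun j _ => ?_
    have h1 : Filter.Tendsto (fun t : ℝ => 2 * (t / 2 + η * height L j)) Filter.atTop
        Filter.atTop := by
      refine Filter.Tendsto.const_mul_atTop (by norm_num) ?_
      apply Filter.tendsto_atTop_add_const_right
      exact Filter.tendsto_id.atTop_div_const (by norm_num)
    have h2 := (Real.tendsto_exp_neg_atTop_nhds_zero.comp h1).const_add 1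
    have h3 := h2.log (by norm_num)
    simpa using h3
  rw [Finset.sum_const_zero] at h
  refine h.congr fun t => ?_
  unfold Gf
  simp only [log_two_cosh, Finset.sum_add_distrib, ← Finset.mul_sum, sum_height]
  simp
  ring

lemma tendsto_t_mul (η : ℝ) (L : ℕ) :
    Filter.Tendsto (fun t => t * ((L : ℝ) / 2 - phiInv η L t)) Filter.atTop (nhds 0) := by
  have h : Filter.Tendsto (fun t : ℝ => ∑ j : Fin L,
      1 / 2 * (t * (1 - Real.tanh (t / 2 + η * height L j)))) Filter.atTop
      (nhds (∑ _j : Fin L, (0 : ℝ))) := by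
    refine tendsto_finsetSum _ fun j _ => ?_
    have h1 : Filter.Tendsto (fun t : ℝ => 2 * Real.exp (-(2 * (η * height L j))) *
        (t * Real.exp (-t))) Filter.atTop (nhds 0) := by
      have := (Real.tendsto_pow_mul_exp_neg_atTop_nhds_zero 1).const_mul
        (2 * Real.exp (-(2 * (η * height L j))))
      simpa using this
    have h2 : Filter.Tendsto (fun t : ℝ => t * (1 - Real.tanh (t / 2 + η * height L j)))
        Filter.atTop (nhds 0) := by
      refine squeeze_zero' ?_ ?_ h1
      · filter_upwards [Filter.eventually_ge_atTop 0] with t ht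
        exact mul_nonneg ht (by linarith [Real.tanh_lt_one (t / 2 + η * height L j)])
      · filter_upwards [Filter.eventually_ge_atTop 0] with t ht
        rw [one_sub_tanh]
        have e : 2 * Real.exp (-(2 * (η * height L j))) * (t * Real.exp (-t)) =
          t * (2 / Real.exp (2 * (t / 2 + η * height L j))) := by
          rw [div_eq_mul_inv, ← Real.exp_neg,
            show -(2 * (t / 2 + η * height L j)) = -(2 * (η * height L j)) + -t by ring,
            Real.exp_add]
          ring
        rw [e]
        gcongr
        linarith
    have h3 := h2.const_mul (1 / 2 : ℝ)
    rwa [mul_zero] at h3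
  rw [Finset.sum_const_zero] at h
  refine h.congr fun t => ?_
  rw [phiInv_eq, ← Finset.mul_sum, ← Finset.mul_sum, Finset.sum_sub_distrib]
  simp
  ring

section inverse
variable {η : ℝ} {L : ℕ} {φ : ℝ → ℝ}

lemma phi_hasDerivAt (hL : 2 ≤ L) (hφ : ∀ t : ℝ, φ (phiInv η L t) = t) (t : ℝ) :
    HasDerivAt φ (1 / 4 * ∑ j : Fin L, (1 - Real.tanh (t / 2 + η * height L j) ^ 2))⁻¹
      (phiInv η L t) := by
  have := var_pos η L hL t
  exact ((hasStrictDerivAt_phiInv η L t).to_local_left_inverse (by positivity)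
    (Filter.Eventually.of_forall hφ)).hasDerivAt

lemma phi_integral (hL : 2 ≤ L) (hφ : ∀ t : ℝ, φ (phiInv η L t) = t) (t : ℝ) :
    ∫ s in (phiInv η L t)..((L : ℝ) / 2), φ s = Gf η L t - t * phiInv η L t := by
  set m := phiInv η L t with hm
  have hmL : m < (L : ℝ) / 2 := (phiInv_mem η L hL t).2
  have hmL' : -(L : ℝ) / 2 < m := (phiInv_mem η L hL t).1
  have hsurj : ∀ s, -(L : ℝ) / 2 < s → s < (L : ℝ) / 2 → ∃ u, phiInv η L u = s := by
    intro s h1 h2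
    have : s ∈ Set.range (phiInv η L) := by rw [phiInv_range η L hL]; exact ⟨h1, h2⟩
    exact this
  set H : ℝ → ℝ := fun s => s * φ s - Gf η L (φ s) with hH
  have hderiv : ∀ s, -(L : ℝ) / 2 < s → s < (L : ℝ) / 2 → HasDerivAt H (φ s) s := by
    intro s h1 h2
    obtain ⟨u, rfl⟩ := hsurj s h1 h2
    have hd := phi_hasDerivAt hL hφ u
    have hG := hasDerivAt_Gf η L (φ (phiInv η L u))
    have := ((hasDerivAt_id _).mul hd).sub (hG.comp _ hd)
    convert! this using 1
    rw [hφ]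
    simp
  have htop : Filter.Tendsto φ (nhdsWithin ((L : ℝ) / 2) (Set.Iio ((L : ℝ) / 2))) Filter.atTop := by
    rw [Filter.tendsto_atTop]
    intro u
    have h1 := (phiInv_mem η L hL u).2
    filter_upwards [Ioo_mem_nhdsLT h1] with s hs
    obtain ⟨v, rfl⟩ := hsurj s (by linarith [hs.1, (phiInv_mem η L hL u).1]) hs.2
    rw [hφ]
    exact ((phiInv_strictMono η L hL).lt_iff_lt.1 hs.1).le
  have hlim : Filter.Tendsto H (nhdsWithin ((L : ℝ) / 2) (Set.Iio ((L : ℝ) / 2))) (nhds 0) := by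
    have h1 := ((tendsto_Gf η L).add (tendsto_t_mul η L)).neg.comp htop
    simp only [add_zero, neg_zero] at h1
    refine h1.congr' ?_
    filter_upwards [Ioo_mem_nhdsLT hmL] with s hs
    obtain ⟨v, rfl⟩ := hsurj s (by linarith [hs.1]) hs.2
    simp only [Function.comp, hH, hφ]
    ring
  -- integrability
  set K : ℝ → ℝ := fun s => (if s < (L : ℝ) / 2 then H s else 0) - t * s with hK
  have hKd : ∀ s ∈ Set.Ioo m ((L : ℝ) / 2), HasDerivAt K (φ s - t) s := by
    intro s hs
    have h1 := (hderiv s (by linarith [hs.1]) hs.2).sub ((hasDerivAt_id s).const_mul t)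
    rw [mul_one] at h1
    refine h1.congr_of_eventuallyEq ?_
    filter_upwards [Iio_mem_nhds hs.2] with x hx
    have hx : x < (L : ℝ) / 2 := hx
    simp [hK, hx]
  have hKc : ContinuousOn K (Set.Icc m ((L : ℝ) / 2)) := by
    refine ContinuousOn.sub ?_ (by fun_prop)
    intro s hs
    rcases hs.2.lt_or_eq with h | h
    · apply ContinuousAt.continuousWithinAt
      refine (hderiv s (by linarith [hs.1]) h).continuousAt.congr ?_
      filter_upwards [Iio_mem_nhds h] with x hx
      have hx : x < (L : ℝ) / 2 := hx
      simp [hx]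
    · subst h
      have : ContinuousWithinAt (fun s => if s < (L : ℝ) / 2 then H s else 0)
          (insert ((L : ℝ) / 2) (Set.Iio ((L : ℝ) / 2))) ((L : ℝ) / 2) := by
        rw [continuousWithinAt_insert_self]
        unfold ContinuousWithinAt
        simp only [lt_irrefl, if_false]
        refine hlim.congr' ?_
        filter_upwards [self_mem_nhdsWithin] with x hx
        have hx : x < (L : ℝ) / 2 := hx
        simp [hx]
      refine this.mono ?_
      intro x hx
      rcases hx.2.lt_or_eq with h | h
      · exact Or.inr h
      · exact Or.inl h
  have hintg : IntervalIntegrable (fun s => φ s - t) MeasureTheory.volume m ((L : ℝ) / 2) := by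
    rw [intervalIntegrable_iff_integrableOn_Ioc_of_le hmL.le]
    refine intervalIntegral.integrableOn_deriv_of_nonneg hKc hKd ?_
    intro s hs
    obtain ⟨v, rfl⟩ := hsurj s (by linarith [hs.1]) hs.2
    rw [hφ]
    have := (phiInv_strictMono η L hL).lt_iff_lt.1 hs.1
    linarith
  have hintg2 : IntervalIntegrable φ MeasureTheory.volume m ((L : ℝ) / 2) := by
    have := hintg.add (intervalIntegrable_const (c := t))
    refine this.congr ?_
    intro x _
    simp
  have hm0 : Filter.Tendsto H (nhdsWithin m (Set.Ioi m)) (nhds (H m)) :=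
    (hderiv m hmL' hmL).continuousAt.continuousWithinAt
  rw [intervalIntegral.integral_eq_sub_of_hasDerivAt_of_tendsto hmL
    (fun s hs => hderiv s (by linarith [hs.1]) hs.2) hintg2 hm0 hlim]
  simp only [hH, hm, hφ]
  ring

end inverse
end S17

namespace S17

lemma sum_abs_height (L : ℕ) : ∑ j : Fin L, |height L j| = 1 / 2 * ((L ^ 2 / 2 : ℕ) : ℝ) := by
  induction L using Nat.twoStepInduction with
  | zero => simp
  | one => simp [height]
  | more L ih _ =>
    rw [Fin.sum_univ_succ, Fin.sum_univ_castSucc]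
    have h1 : ∀ j : Fin L, height (L + 2) (Fin.succ (Fin.castSucc j)) = height L j := by
      intro j
      unfold height
      simp only [Fin.val_succ, Fin.val_castSucc]
      push_cast; ring
    have h2 : |height (L + 2) 0| = ((L : ℝ) + 1) / 2 := by
      unfold height
      simp only [Fin.val_zero]
      push_cast
      rw [abs_of_nonpos] <;> linarith [(Nat.cast_nonneg L : (0 : ℝ) ≤ L)]
    have h3 : |height (L + 2) (Fin.succ (Fin.last L))| = ((L : ℝ) + 1) / 2 := by
      unfold height
      simp only [Fin.val_succ, Fin.val_last]
      push_cast
      rw [abs_of_nonneg] <;> linarith [(Nat.cast_nonneg L : (0 : ℝ) ≤ L)]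
    have h4 : (L + 2) ^ 2 / 2 = L ^ 2 / 2 + (2 * L + 2) := by
      rw [show (L + 2) ^ 2 = L ^ 2 + 2 * (2 * L + 2) by ring, Nat.add_mul_div_left _ _ (by norm_num)]
    simp only [h1]
    rw [h2, h3, ih, h4]
    push_cast; ring

lemma factor_sum (y x : ℝ) :
    ((Real.cos x : ℂ) + ((Real.tanh y * Real.sin x : ℝ) : ℂ) * Complex.I) =
      ∑ b : Bool, ((Real.exp (2 * sval b * y) / (2 * Real.cosh y) : ℝ) : ℂ) *
        Complex.exp (((2 * sval b * x : ℝ) : ℂ) * Complex.I) := by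
  have hp := Real.cosh_pos y
  rw [Fintype.sum_bool]
  have h1 : (2 : ℝ) * sval true = 1 := by norm_num [sval]
  have h2 : (2 : ℝ) * sval false = -1 := by norm_num [sval]
  rw [h1, h2, Complex.exp_mul_I, Complex.exp_mul_I, ← Complex.ofReal_cos, ← Complex.ofReal_sin,
    ← Complex.ofReal_cos, ← Complex.ofReal_sin]
  simp only [one_mul, neg_mul, Real.cos_neg, Real.sin_neg]
  have e1 : Real.exp y / (2 * Real.cosh y) + Real.exp (-y) / (2 * Real.cosh y) = 1 := by
    rw [← add_div, Real.cosh_eq]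
    have := Real.exp_pos y
    have := Real.exp_pos (-y)
    field_simp
  have e2 : Real.exp y / (2 * Real.cosh y) - Real.exp (-y) / (2 * Real.cosh y) = Real.tanh y := by
    rw [← sub_div, Real.tanh_eq_sinh_div_cosh, Real.sinh_eq]
    field_simp
  rw [← e2]
  have e1' := congrArg (fun r : ℝ => (r : ℂ)) e1
  push_cast at e1' ⊢
  linear_combination (-Complex.cos x) * e1'

section rep
variable {ι : Type*} [Fintype ι]

/-- Boltzmann weights, normalised. -/
def wt (y : ι → ℝ) (s : ι → Bool) : ℝ := ∏ p, (Real.exp (2 * sval (s p) * y p) / (2 * Real.cosh (y p)))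

lemma Fch_eq_sum (y : ι → ℝ) (x : ℝ) :
    Fch (fun p => Real.tanh (y p)) x = ∑ s : ι → Bool, ((wt y s : ℝ) : ℂ) *
      Complex.exp (((2 * (∑ p, sval (s p) - (∑ p, Real.tanh (y p)) / 2) * x : ℝ) : ℂ) * Complex.I) := by
  unfold Fch
  rw [Finset.prod_congr rfl fun p _ => factor_sum (y p) x, Fintype.prod_sum, Finset.sum_mul]
  refine Finset.sum_congr rfl fun s _ => ?_
  rw [Finset.prod_mul_distrib, ← Complex.exp_sum, mul_assoc, ← Complex.exp_add]
  unfold wt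
  rw [Complex.ofReal_prod]
  congr 2
  rw [← Finset.sum_mul, ← add_mul, ← Complex.ofReal_sum, ← Complex.ofReal_add]
  congr 2
  rw [← Finset.sum_mul, ← Finset.mul_sum]
  ring

lemma int_cos (S : ℤ) : ∫ x in (-(Real.pi / 2))..(Real.pi / 2), Real.cos (2 * (S : ℝ) * x) =
    if S = 0 then Real.pi else 0 := by
  split_ifs with h
  · subst h; simp
  · have hS : (2 * (S : ℝ)) ≠ 0 := by
      have : (S : ℝ) ≠ 0 := by exact_mod_cast h
      positivity
    rw [intervalIntegral.integral_comp_mul_left (fun x => Real.cos x) hS, integral_cos]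
    have h1 : 2 * (S : ℝ) * (Real.pi / 2) = S * Real.pi := by ring
    have h2 : 2 * (S : ℝ) * -(Real.pi / 2) = -(S * Real.pi) := by ring
    rw [h1, h2, Real.sin_neg, Real.sin_int_mul_pi]
    simp

lemma Iint_eq (y : ι → ℝ) (j : ℤ)
    (hj : (∑ p, Real.tanh (y p)) / 2 = -(Fintype.card ι : ℝ) / 2 + j) :
    Iint (fun p => Real.tanh (y p)) = Real.pi * ∑ s ∈ Finset.univ.filter
      (fun s : ι → Bool => ∑ p, sval (s p) = (∑ p, Real.tanh (y p)) / 2), wt y s := by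
  unfold Iint
  have hre : ∀ x : ℝ, (Fch (fun p => Real.tanh (y p)) x).re = ∑ s : ι → Bool, wt y s *
      Real.cos (2 * (∑ p, sval (s p) - (∑ p, Real.tanh (y p)) / 2) * x) := by
    intro x
    rw [Fch_eq_sum, Complex.re_sum]
    refine Finset.sum_congr rfl fun s _ => ?_
    rw [Complex.re_ofReal_mul, Complex.exp_ofReal_mul_I_re]
  simp only [hre]
  rw [intervalIntegral.integral_finsetSum]
  swap
  · intro s _
    exact (by fun_prop : Continuous fun x : ℝ => wt y s *
      Real.cos (2 * (∑ p, sval (s p) - (∑ p, Real.tanh (y p)) / 2) * x)).intervalIntegrable _ _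
  rw [Finset.mul_sum, Finset.sum_filter]
  refine Finset.sum_congr rfl fun s _ => ?_
  rw [intervalIntegral.integral_const_mul]
  have hS : ∃ S : ℤ, ∑ p, sval (s p) - (∑ p, Real.tanh (y p)) / 2 = S := by
    refine ⟨(∑ p, if s p then 1 else 0) - j, ?_⟩
    rw [hj]
    have : ∀ p, sval (s p) = (if s p then 1 else 0) - 1 / 2 := by
      intro p; unfold sval; split_ifs <;> norm_num
    simp only [this, Finset.sum_sub_distrib]
    simp
    ring
  obtain ⟨S, hS⟩ := hS
  rw [hS, int_cos]
  have hiff : (∑ p, sval (s p) = (∑ p, Real.tanh (y p)) / 2) ↔ S = 0 := by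
    rw [← sub_eq_zero, hS]; exact_mod_cast Iff.rfl
  by_cases h : S = 0
  · rw [if_pos h, if_pos (hiff.2 h)]; ring
  · rw [if_neg h, if_neg (fun h' => h (hiff.1 h'))]; ring

end rep

/-- the field at a site -/
def yv (η : ℝ) (L n : ℕ) (t : ℝ) (p : Fin L × Fin n) : ℝ := t / 2 + η * height L p.1

lemma sum_prod_fst (L n : ℕ) (f : Fin L → ℝ) : ∑ p : Fin L × Fin n, f p.1 = n * ∑ j, f j := by
  rw [Fintype.sum_prod_type]
  simp [Finset.mul_sum]

lemma Zpart_eq (q η : ℝ) (hq0 : 0 < q) (hη : η = -Real.log q) (L n : ℕ) (hn : 1 ≤ n)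
    (j : ℕ) (m t : ℝ) (hm : m = -(L : ℝ) / 2 + (j : ℝ) / (n : ℝ)) (ht : phiInv η L t = m) :
    Zpart q L n (m * n) = q ^ (((n : ℝ) / 2) * ((L ^ 2 / 2 : ℕ) : ℝ)) *
      Real.exp ((n : ℝ) * (Gf η L t - t * m)) *
      ((1 / Real.pi) * Iint (fun p => Real.tanh (yv η L n t p))) := by
  have hn0 : (n : ℝ) ≠ 0 := by positivity
  have hsum : (∑ p, Real.tanh (yv η L n t p)) / 2 = m * n := by
    unfold yv
    rw [sum_prod_fst L n (fun j => Real.tanh (t / 2 + η * height L j)), ← ht, phiInv_eq]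
    ring
  have hI := Iint_eq (yv η L n t) (j : ℤ) (by
    rw [hsum, hm]
    simp
    field_simp)
  rw [hsum] at hI
  rw [hI, ← mul_assoc (1 / Real.pi), one_div_mul_cancel Real.pi_pos.ne', one_mul, Finset.mul_sum]
  unfold Zpart
  refine Finset.sum_congr (by ext s; simp) fun s hs => ?_
  have hs' : ∑ p, sval (s p) = m * n := (Finset.mem_filter.1 hs).2
  have hwt : wt (yv η L n t) s = Real.exp (t * (m * n) + η * (∑ p, 2 * sval (s p) * height L p.1) -
      n * Gf η L t) := by
    have h1 : wt (yv η L n t) s = Real.exp (∑ p, (2 * sval (s p) * yv η L n t p -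
        Real.log (2 * Real.cosh (yv η L n t p)))) := by
      unfold wt
      rw [Real.exp_sum]
      refine Finset.prod_congr rfl fun p _ => ?_
      have := Real.cosh_pos (yv η L n t p)
      rw [Real.exp_sub, Real.exp_log (by positivity)]
    rw [h1, Finset.sum_sub_distrib]
    congr 2
    · rw [← hs', Finset.mul_sum, Finset.mul_sum, ← Finset.sum_add_distrib]
      refine Finset.sum_congr rfl fun p _ => ?_
      unfold yv; ring
    · unfold yv Gf
      exact sum_prod_fst L n (fun j => Real.log (2 * Real.cosh (t / 2 + η * height L j)))
  have hq : ∀ z : ℝ, q ^ z = Real.exp (-η * z) := by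
    intro z; rw [Real.rpow_def_of_pos hq0, hη]; ring_nf
  rw [hwt, hq, hq, ← Real.exp_add, ← Real.exp_add]
  congr 1
  rw [Finset.sum_sub_distrib, sum_prod_fst L n (fun j => |height L j|), sum_abs_height]
  ring

end S17


namespace S17

lemma sqrt_shape (A u : ℝ) (hA : 0 < A) (hu : 0 < u) :
    Real.sqrt (Real.pi / (A / 2 * u ^ 2)) = Real.pi * Real.sqrt (2 / (Real.pi * A)) / u := by
  have hpi := Real.pi_pos
  have h : Real.pi / (A / 2 * u ^ 2) = (Real.pi / u) ^ 2 * (2 / (Real.pi * A)) := by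
    field_simp
  rw [h, Real.sqrt_mul (by positivity), Real.sqrt_sq (by positivity)]
  ring

lemma sqrt_prod (A : ℝ) (hA : 0 < A) :
    Real.sqrt (2 / (Real.pi * A)) * Real.sqrt (Real.pi * A / 2) = 1 := by
  have hpi := Real.pi_pos
  rw [← Real.sqrt_mul (by positivity)]
  have : 2 / (Real.pi * A) * (Real.pi * A / 2) = 1 := by field_simp
  rw [this, Real.sqrt_one]

lemma upper_pure (A δ E I : ℝ) (hA : 0 < A) (hδ : 0 < δ) (hδ1 : δ ≤ 1)
    (hI : I ≤ Real.sqrt (Real.pi / (A / 2 * (1 - δ / 6) ^ 2)) + Real.pi * E) :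
    (1 / Real.pi) * I ≤ Real.sqrt (2 / (Real.pi * A)) *
      (1 + (δ / (6 - δ) + Real.sqrt (Real.pi * A / 2) * E)) := by
  have hpi := Real.pi_pos
  have hu : 0 < 1 - δ / 6 := by linarith
  rw [sqrt_shape A _ hA hu] at hI
  have hp := sqrt_prod A hA
  set r := Real.sqrt (2 / (Real.pi * A))
  set w := Real.sqrt (Real.pi * A / 2)
  have h1 : r * (1 + (δ / (6 - δ) + w * E)) = r / (1 - δ / 6) + E := by
    have h6 : 6 - δ ≠ 0 := by linarith
    have h6' : 1 - δ / 6 = (6 - δ) / 6 := by ring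
    have : r * (1 + (δ / (6 - δ) + w * E)) = r * (1 + δ / (6 - δ)) + (r * w) * E := by ring
    rw [this, hp, h6']
    field_simp
    ring
  rw [h1]
  calc (1 / Real.pi) * I ≤ (1 / Real.pi) * (Real.pi * r / (1 - δ / 6) + Real.pi * E) := by
        gcongr
    _ = _ := by field_simp

lemma lower_pure (A δ C Q I : ℝ) (hA : 0 < A) (hδ : 0 < δ) (hδ1 : δ < 1)
    (hQ : 1 - δ - Q ≤ Real.sqrt (1 - δ) - C ^ 2 * δ / (6 * A ^ 2 * (1 - δ / 6) ^ 5))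
    (hI : Real.sqrt (Real.pi / (A / 2 / (1 - δ))) * (1 - Real.exp (-(A / 2 / (1 - δ)) * δ))
      - C ^ 2 * δ / 18 * (3 / (4 * (A / 2 * (1 - δ / 6) ^ 2) ^ 2) *
        Real.sqrt (Real.pi / (A / 2 * (1 - δ / 6) ^ 2)))
      - Real.pi * Real.exp (-(A / 2 * (1 - δ / 6) ^ 2) * δ) ≤ I) :
    Real.sqrt (2 / (Real.pi * A)) * (1 - (δ + Q + (1 + Real.sqrt (Real.pi * A / 2)) *
      Real.exp (-(A / 2 * (1 - δ / 6) ^ 2) * δ))) ≤ (1 / Real.pi) * I := by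
  have hpi := Real.pi_pos
  have hu : 0 < 1 - δ / 6 := by linarith
  have hd : 0 < 1 - δ := by linarith
  have hE : Real.exp (-(A / 2 / (1 - δ)) * δ) ≤ Real.exp (-(A / 2 * (1 - δ / 6) ^ 2) * δ) := by
    apply Real.exp_le_exp.2
    have h1 : A / 2 * (1 - δ / 6) ^ 2 ≤ A / 2 := by
      have : (1 - δ / 6) ^ 2 ≤ 1 := by nlinarith
      nlinarith
    have h2 : A / 2 ≤ A / 2 / (1 - δ) := by
      rw [le_div_iff₀ hd]; nlinarith
    nlinarith
  have hs : Real.sqrt (Real.pi / (A / 2 / (1 - δ))) =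
      Real.pi * Real.sqrt (2 / (Real.pi * A)) * Real.sqrt (1 - δ) := by
    have h : Real.pi / (A / 2 / (1 - δ)) = Real.pi ^ 2 * (2 / (Real.pi * A)) * (1 - δ) := by
      field_simp
    rw [h, Real.sqrt_mul (by positivity), Real.sqrt_mul (by positivity), Real.sqrt_sq hpi.le]
  rw [sqrt_shape A _ hA hu, hs] at hI
  have hp := sqrt_prod A hA
  have hs1 : Real.sqrt (1 - δ) ≤ 1 := Real.sqrt_le_one.2 (by linarith)
  have hs0 : 0 ≤ Real.sqrt (1 - δ) := Real.sqrt_nonneg _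
  have hr0 : 0 ≤ Real.sqrt (2 / (Real.pi * A)) := Real.sqrt_nonneg _
  have hE0 := Real.exp_pos (-(A / 2 / (1 - δ)) * δ)
  set r := Real.sqrt (2 / (Real.pi * A))
  set w := Real.sqrt (Real.pi * A / 2)
  set E := Real.exp (-(A / 2 * (1 - δ / 6) ^ 2) * δ)
  set E' := Real.exp (-(A / 2 / (1 - δ)) * δ)
  set s := Real.sqrt (1 - δ)
  set K := C ^ 2 * δ / (6 * A ^ 2 * (1 - δ / 6) ^ 5) with hK
  have hmid : C ^ 2 * δ / 18 * (3 / (4 * (A / 2 * (1 - δ / 6) ^ 2) ^ 2) *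
      (Real.pi * r / (1 - δ / 6))) = Real.pi * (r * K) := by
    rw [hK]; field_simp; ring
  rw [hmid] at hI
  have hI' : Real.pi * (r * s * (1 - E') - r * K - E) ≤ I := by nlinarith [hI]
  have h3 : r * s * (1 - E') - r * K - E ≤ (1 / Real.pi) * I := by
    rw [one_div, ← div_eq_inv_mul, le_div_iff₀ hpi]; linarith
  refine le_trans ?_ h3
  have h4 : r * (1 - (δ + Q + (1 + w) * E)) = r * (1 - δ - Q) - r * E - (r * w) * E := by ring
  rw [h4, hp]
  have h5 : s * E' ≤ E := by nlinarith
  have h6 := mul_le_mul_of_nonneg_left hQ hr0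
  have h7 := mul_le_mul_of_nonneg_left h5 hr0
  nlinarith

lemma K_case1 (A δ Cs δ4 X : ℝ) (hA : 0 < A) (hδ : 0 < δ) (hδ1 : δ < 1) (hne : 1 - 2 * δ ≠ 0)
    (hδ4 : δ ≤ δ4) (hX : Cs ^ 2 = 4 * X * A ^ 2) (hX0 : 0 ≤ X) :
    1 - δ - 4 * δ4 * X / (1 - 2 * δ) ^ 4 ≤
      Real.sqrt (1 - δ) - Cs ^ 2 * δ / (6 * A ^ 2 * (1 - δ / 6) ^ 5) := by
  have h1 : 1 - δ ≤ Real.sqrt (1 - δ) := by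
    apply Real.le_sqrt_of_sq_le; nlinarith
  have h2 : 4 * δ4 * X ≤ 4 * δ4 * X / (1 - 2 * δ) ^ 4 := by
    have hp : 0 < (1 - 2 * δ) ^ 4 := by positivity
    have hle : (1 - 2 * δ) ^ 4 ≤ 1 := by
      have hq : (1 - 2 * δ) ^ 2 ≤ 1 := by nlinarith
      have hq0 : 0 ≤ (1 - 2 * δ) ^ 2 := sq_nonneg _
      nlinarith
    rw [le_div_iff₀ hp]
    have : 0 ≤ 4 * δ4 * X := by
      have : 0 ≤ δ4 := by linarith
      positivity
    nlinarith
  have h5 : (1 / 6 : ℝ) ≤ (1 - δ / 6) ^ 5 := by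
    have : (5 / 6 : ℝ) ^ 5 ≤ (1 - δ / 6) ^ 5 := by gcongr; linarith
    refine le_trans ?_ this; norm_num
  have h3 : Cs ^ 2 * δ / (6 * A ^ 2 * (1 - δ / 6) ^ 5) ≤ 4 * δ4 * X := by
    rw [hX, div_le_iff₀ (by positivity)]
    have ha : δ * X ≤ δ4 * X := by gcongr
    have hb : 0 ≤ δ4 * X := mul_nonneg (by linarith) hX0
    have hc : δ4 * X * (1 / 6) ≤ δ4 * X * (1 - δ / 6) ^ 5 := by gcongr
    have hd : δ * X ≤ 6 * (δ4 * X * (1 - δ / 6) ^ 5) := by linarith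
    have := mul_le_mul_of_nonneg_left hd (by positivity : 0 ≤ 4 * A ^ 2)
    nlinarith
  linarith

lemma K_case2 (A δ : ℝ) (hA : 0 < A) (hδ : δ = 1 / 2) :
    1 - δ - 0 ≤ Real.sqrt (1 - δ) - A ^ 2 * δ / (6 * A ^ 2 * (1 - δ / 6) ^ 5) := by
  subst hδ
  have h1 : (0.7 : ℝ) ≤ Real.sqrt (1 - 1 / 2) := by
    apply Real.le_sqrt_of_sq_le; norm_num
  have h2 : A ^ 2 * (1 / 2) / (6 * A ^ 2 * (1 - 1 / 2 / 6) ^ 5) ≤ 0.2 := by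
    rw [div_le_iff₀ (by positivity)]
    have : 0 < A ^ 2 := by positivity
    norm_num
    nlinarith
  norm_num at *
  linarith

lemma Zpart_nonneg (q : ℝ) (hq0 : 0 < q) (L n : ℕ) (M : ℝ) : 0 ≤ Zpart q L n M :=
  Finset.sum_nonneg fun _ _ => (Real.rpow_pos_of_pos hq0 _).le

end S17


namespace S17

lemma final_bounds (q η : ℝ) (hq0 : 0 < q) (hη : η = -Real.log q)
    (L n : ℕ) (hL : 2 ≤ L) (hn : 1 ≤ n) (φ : ℝ → ℝ) (hφ : ∀ t : ℝ, φ (S17.phiInv η L t) = t)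
    (j : ℕ) (hj1 : 1 ≤ j) (hj2 : j ≤ L * n - 1) (m : ℝ)
    (hm : m = -(L : ℝ) / 2 + (j : ℝ) / (n : ℝ)) (ε : ℝ) (hε0 : 0 < ε) (hε1 : ε < 1/4) :
            (S17.Zpart q L n (m * n) ≤
              q ^ (((n : ℝ) / 2) * ((L ^ 2 / 2 : ℕ) : ℝ)) *
                Real.sqrt (deriv φ m / (2 * Real.pi * n)) *
                Real.exp ((n : ℝ) * ∫ s in m..((L : ℝ) / 2), φ s) *
                (1 + ((n : ℝ) ^ (-1 + 2 * ε) / (6 - (n : ℝ) ^ (-1 + 2 * ε)) +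
                  Real.sqrt (2 * Real.pi * n / deriv φ m) *
                    Real.exp (-2 * (n : ℝ) ^ (2 * ε) *
                      (1 - (n : ℝ) ^ (-1 + 2 * ε) / 6) ^ 2 / deriv φ m)))) ∧
            (q ^ (((n : ℝ) / 2) * ((L ^ 2 / 2 : ℕ) : ℝ)) *
                Real.sqrt (deriv φ m / (2 * Real.pi * n)) *
                Real.exp ((n : ℝ) * ∫ s in m..((L : ℝ) / 2), φ s) *
                (1 - ((n : ℝ) ^ (-1 + 2 * ε) +
                  4 * (n : ℝ) ^ (-1 + 4 * ε) * (m * deriv φ m) ^ 2 /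
                    (1 - 2 * (n : ℝ) ^ (-1 + 2 * ε)) ^ 4 +
                  (1 + Real.sqrt (2 * Real.pi * n / deriv φ m)) *
                    Real.exp (-2 * (n : ℝ) ^ (2 * ε) *
                      (1 - (n : ℝ) ^ (-1 + 2 * ε) / 6) ^ 2 / deriv φ m)))
              ≤ S17.Zpart q L n (m * n)) := by
  have hpi := Real.pi_pos
  have hnp : (0 : ℝ) < n := by exact_mod_cast hn
  have hmI : m ∈ Set.Ioo (-(L : ℝ) / 2) ((L : ℝ) / 2) := by
    have h1 : (0 : ℝ) < j := by exact_mod_cast hj1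
    have h2 : (j : ℝ) < L * n := by
      have h0 : 0 < L * n := Nat.mul_pos (by omega) (by omega)
      have : j < L * n := by omega
      exact_mod_cast this
    have h3 : (j : ℝ) / n < L := by rw [div_lt_iff₀ hnp]; exact h2
    have h4 : 0 < (j : ℝ) / n := by positivity
    constructor <;> rw [hm] <;> linarith
  rw [← phiInv_range η L hL] at hmI
  obtain ⟨t, ht⟩ := hmI
  have hZ := Zpart_eq q η hq0 hη L n hn j m t hm ht
  have hD := (phi_hasDerivAt hL hφ t).deriv
  have hintg := phi_integral hL hφ t
  rw [ht] at hD hintg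
  have hV := var_pos η L hL t
  set V := ∑ j : Fin L, (1 - Real.tanh (t / 2 + η * height L j) ^ 2) with hVdef
  set T : Fin L × Fin n → ℝ := fun p => Real.tanh (yv η L n t p) with hTdef
  have hA : ∑ p, (1 - T p ^ 2) = n * V := by
    rw [hVdef, ← sum_prod_fst L n (fun j => 1 - Real.tanh (t / 2 + η * height L j) ^ 2)]
    rfl
  have hT : ∀ p, T p ^ 2 < 1 := fun p => by
    simpa using (sq_lt_one_iff_abs_lt_one _).2 (Real.abs_tanh_lt_one (yv η L n t p))
  have hsumT : ∑ p, T p = 2 * (m * n) := by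
    have : ∑ p, T p = n * ∑ j : Fin L, Real.tanh (t / 2 + η * height L j) := by
      rw [← sum_prod_fst L n (fun j => Real.tanh (t / 2 + η * height L j))]
      rfl
    rw [this, ← ht, phiInv_eq]
    ring
  rw [hintg, hZ, hD]
  set A := ∑ p, (1 - T p ^ 2) with hAdef
  have hA0 : 0 < A := by rw [hA]; positivity
  have e1 : (1 / 4 * V)⁻¹ / (2 * Real.pi * n) = 2 / (Real.pi * A) := by
    rw [hA]; field_simp; norm_num
  have e2 : 2 * Real.pi * n / (1 / 4 * V)⁻¹ = Real.pi * A / 2 := by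
    rw [hA]; field_simp; norm_num
  rw [e1, e2]
  set δ := (n : ℝ) ^ (-1 + 2 * ε) with hδdef
  have hδ0 : 0 < δ := Real.rpow_pos_of_pos hnp _
  have hn1 : (1 : ℝ) ≤ n := by exact_mod_cast hn
  have hδ1 : δ ≤ 1 := Real.rpow_le_one_of_one_le_of_nonpos hn1 (by linarith)
  have hnδ : (n : ℝ) ^ (2 * ε) = n * δ := by
    rw [hδdef, Real.rpow_add hnp, Real.rpow_neg_one]; field_simp
  have e3 : -2 * (n : ℝ) ^ (2 * ε) * (1 - δ / 6) ^ 2 / (1 / 4 * V)⁻¹ =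
      -(A / 2 * (1 - δ / 6) ^ 2) * δ := by
    rw [hnδ, hA]; field_simp; ring
  rw [e3]
  set P := q ^ (((n : ℝ) / 2) * ((L ^ 2 / 2 : ℕ) : ℝ)) with hP
  have hP0 : 0 < P := Real.rpow_pos_of_pos hq0 _
  set X := Real.exp ((n : ℝ) * (Gf η L t - t * m)) with hX
  have hX0 : 0 < X := Real.exp_pos _
  set r := Real.sqrt (2 / (Real.pi * A)) with hr
  set E := Real.exp (-(A / 2 * (1 - δ / 6) ^ 2) * δ) with hE
  have key : ∀ a b : ℝ, r * a ≤ b → P * r * X * a ≤ P * X * b := by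
    intro a b h
    have := mul_le_mul_of_nonneg_left h (mul_pos hP0 hX0).le
    calc P * r * X * a = P * X * (r * a) := by ring
      _ ≤ _ := this
  constructor
  · have := upper_pure A δ E (Iint T) hA0 hδ0 hδ1 (Iint_upper T hA0 hδ0 hδ1)
    calc P * X * (1 / Real.pi * Iint T) ≤ P * X * (r * (1 + (δ / (6 - δ) +
          Real.sqrt (Real.pi * A / 2) * E))) := by gcongr
      _ = _ := by ring
  · have hδ4 : δ ≤ (n : ℝ) ^ (-1 + 4 * ε) := Real.rpow_le_rpow_of_exponent_le hn1 (by linarith)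
    rcases hδ1.eq_or_lt with hδe | hδlt
    · rw [← hZ]
      refine le_trans ?_ (Zpart_nonneg q hq0 L n _)
      apply mul_nonpos_of_nonneg_of_nonpos (by positivity)
      have h1 : 0 ≤ 4 * (n : ℝ) ^ (-1 + 4 * ε) * (m * (1 / 4 * V)⁻¹) ^ 2 / (1 - 2 * δ) ^ 4 := by
        have : 0 ≤ (n : ℝ) ^ (-1 + 4 * ε) := by positivity
        have : 0 ≤ (1 - 2 * δ) ^ 4 := by positivity
        positivity
      have h2 : 0 ≤ (1 + Real.sqrt (Real.pi * A / 2)) * E := by positivity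
      linarith
    · apply key
      by_cases hne : 1 - 2 * δ = 0
      · have hδh : δ = 1 / 2 := by linarith
        have h0 : 4 * (n : ℝ) ^ (-1 + 4 * ε) * (m * (1 / 4 * V)⁻¹) ^ 2 / (1 - 2 * δ) ^ 4 = 0 := by
          rw [hne]; simp
        rw [h0]
        refine lower_pure A δ A 0 (Iint T) hA0 hδ0 hδlt (K_case2 A δ hA0 hδh) ?_
        refine Iint_lower T hT hA0 hδ0 hδlt fun y hy0 hy => ?_
        refine sum_g_abs T hT _ (sq_nonneg _) ?_
        have h1 : Real.sin y ^ 2 ≤ y ^ 2 := Real.sin_sq_le_sq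
        have h2 : y ^ 2 ≤ δ := by
          have := pow_le_pow_left₀ hy0 hy 2
          rwa [Real.sq_sqrt hδ0.le] at this
        linarith
      · refine lower_pure A δ (4 * |∑ p, T p|) _ (Iint T) hA0 hδ0 hδlt
          (K_case1 A δ _ _ _ hA0 hδ0 hδlt hne hδ4 ?_ (sq_nonneg _)) ?_
        · rw [mul_pow, sq_abs, hsumT, hA]
          field_simp
          ring
        · refine Iint_lower T hT hA0 hδ0 hδlt fun y hy0 hy => ?_
          refine sum_g_sym T hT (Equiv.prodCongr Fin.revPerm (Equiv.refl _)) ?_ _ (sq_nonneg _) ?_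
          · have hTs : ∀ p : Fin L × Fin n, T p + T (Equiv.prodCongr Fin.revPerm (Equiv.refl _) p) =
                2 * (Real.sinh t / (Real.cosh t + Real.cosh (2 * η * height L p.1))) :=
              fun p => tanh_sum_rev η L t p.1
            have hcp : ∀ p : Fin L × Fin n,
                0 < Real.cosh t + Real.cosh (2 * η * height L p.1) := fun p =>
              add_pos (Real.cosh_pos _) (Real.cosh_pos _)
            rcases le_total 0 (Real.sinh t) with hs | hs
            · left; intro p; rw [hTs]
              have := div_nonneg hs (hcp p).le
              linarith
            · right; intro p; rw [hTs]
              have := div_nonpos_of_nonpos_of_nonneg hs (hcp p).le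
              linarith
          · have hy1 : y ≤ 1 := hy.trans (Real.sqrt_le_one.2 hδ1)
            have hc := cos_ge_half (x := y) (by rw [abs_of_nonneg hy0]; exact hy1)
            have := Real.sin_sq_add_cos_sq y
            nlinarith

end S17


/-- sharp saddle-point bounds for the canonical partition function
`Z(L,n,mn)` of the XXZ interface.  `φ_L⁻¹` is a strictly increasing smooth bijection of `ℝ`
onto `(−L/2, L/2)`; writing `φ_L` for its inverse, for every
`m ∈ {−L/2 + 1/n, …, L/2 − 1/n}` (i.e. `m = −L/2 + j/n`, `1 ≤ j ≤ Ln−1`) and every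
`0 < ε < 1/4` one has the stated upper and lower bounds for `Z(L,n,mn)` with errors
`ε_upper, ε_lower`. -/
theorem stmt17 (q η : ℝ) (hq0 : 0 < q) (hq1 : q < 1) (hη : η = -Real.log q)
    (L n : ℕ) (hL : 2 ≤ L) (hn : 1 ≤ n) :
    StrictMono (S17.phiInv η L) ∧
    ContDiff ℝ (⊤ : ℕ∞) (S17.phiInv η L) ∧
    Set.range (S17.phiInv η L) = Set.Ioo (-(L : ℝ) / 2) ((L : ℝ) / 2) ∧
    ∀ φ : ℝ → ℝ, (∀ t : ℝ, φ (S17.phiInv η L t) = t) →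
      ∀ j : ℕ, 1 ≤ j → j ≤ L * n - 1 →
        ∀ m : ℝ, m = -(L : ℝ) / 2 + (j : ℝ) / (n : ℝ) →
          ∀ ε : ℝ, 0 < ε → ε < 1/4 →
            (S17.Zpart q L n (m * n) ≤
              q ^ (((n : ℝ) / 2) * ((L ^ 2 / 2 : ℕ) : ℝ)) *
                Real.sqrt (deriv φ m / (2 * Real.pi * n)) *
                Real.exp ((n : ℝ) * ∫ s in m..((L : ℝ) / 2), φ s) *
                (1 + ((n : ℝ) ^ (-1 + 2 * ε) / (6 - (n : ℝ) ^ (-1 + 2 * ε)) +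
                  Real.sqrt (2 * Real.pi * n / deriv φ m) *
                    Real.exp (-2 * (n : ℝ) ^ (2 * ε) *
                      (1 - (n : ℝ) ^ (-1 + 2 * ε) / 6) ^ 2 / deriv φ m)))) ∧
            (q ^ (((n : ℝ) / 2) * ((L ^ 2 / 2 : ℕ) : ℝ)) *
                Real.sqrt (deriv φ m / (2 * Real.pi * n)) *
                Real.exp ((n : ℝ) * ∫ s in m..((L : ℝ) / 2), φ s) *
                (1 - ((n : ℝ) ^ (-1 + 2 * ε) +
                  4 * (n : ℝ) ^ (-1 + 4 * ε) * (m * deriv φ m) ^ 2 /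
                    (1 - 2 * (n : ℝ) ^ (-1 + 2 * ε)) ^ 4 +
                  (1 + Real.sqrt (2 * Real.pi * n / deriv φ m)) *
                    Real.exp (-2 * (n : ℝ) ^ (2 * ε) *
                      (1 - (n : ℝ) ^ (-1 + 2 * ε) / 6) ^ 2 / deriv φ m)))
              ≤ S17.Zpart q L n (m * n)) := by
  refine ⟨S17.phiInv_strictMono η L hL, S17.phiInv_contDiff η L, S17.phiInv_range η L hL, ?_⟩
  intro φ hφ j hj1 hj2 m hm ε hε0 hε1
  exact S17.final_bounds q η hq0 hη L n hL hn φ hφ j hj1 hj2 m hm ε hε0 hε1
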